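/- arXiv:math-ph/0702087 — 2 statements merged into one kernel-verified Lean document; each statement's English description precedes it below -/
import Mathlib

section
/- Let ν > 0, c > 0, t > 0, and let F : (0,∞) × [0,t] → ℂ be continuous with continuous partial derivative ∂₁F in the first variable. Define G(z) = ∫₀ᵗ e^{−ν z² c (t−τ)} F(z,τ) dτ for z > 0. Then G is differentiable on (0,∞) and for every z > 0, |G′(z)| ≤ 4 ν^{−1/2} C₀(z)^{1/2} / (z² c^{1/2}) + (2ν)^{−1/2} C₂(z)^{1/2} / (z c^{1/2}), where C₀(z) = ∫₀ᵗ |F(z,τ)|² dτ and C₂(z) = ∫₀ᵗ |∂₁F(z,τ)|² dτ. (This is the content of the paper's Lemma 8.10: the bound on the z-derivative of the Duhamel integral in the Fourier representation of the Navier–Stokes solution, with z playing the role of |k| and c = |e_k − e_λ|².) -/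
open MeasureTheory Real

open Set intervalIntegral

/-- Differentiation under the integral sign over a compact interval, for a kernel with jointly
continuous derivative on `U × [a, b]`, `U` open. -/
theorem hasDerivAt_intervalIntegral_of_continuousOn {E : Type*} [NormedAddCommGroup E]
    [NormedSpace ℝ E] {U : Set ℝ} (hU : IsOpen U) {a b : ℝ} (hab : a ≤ b) {f f' : ℝ → ℝ → E}
    (hf : ∀ x ∈ U, ContinuousOn (f x) (Icc a b))
    (hf' : ContinuousOn (fun p : ℝ × ℝ => f' p.1 p.2) (U ×ˢ Icc a b))
    (hderiv : ∀ x ∈ U, ∀ s ∈ Icc a b, HasDerivAt (fun w => f w s) (f' x s) x)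
    {x : ℝ} (hx : x ∈ U) :
    HasDerivAt (fun w => ∫ s in a..b, f w s) (∫ s in a..b, f' x s) x := by
  obtain ⟨K, hK, hxK, hKU⟩ := exists_compact_subset hU hx
  obtain ⟨M, hM⟩ := (hK.prod isCompact_Icc).exists_bound_of_continuousOn
    (hf'.mono (prod_mono hKU subset_rfl))
  have hsub : uIoc a b ⊆ Icc a b := by
    rw [uIoc_of_le hab]
    exact Ioc_subset_Icc_self
  have hmeas : ∀ g : ℝ → E, ContinuousOn g (Icc a b) →
      AEStronglyMeasurable g (volume.restrict (uIoc a b)) := fun g hg =>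
    (hg.aestronglyMeasurable_of_isCompact isCompact_Icc measurableSet_Icc).mono_set hsub
  have hf'x : ContinuousOn (f' x) (Icc a b) :=
    hf'.comp (f := fun s => (x, s)) (by fun_prop) fun s hs => ⟨hx, hs⟩
  refine (hasDerivAt_integral_of_dominated_loc_of_deriv_le (bound := fun _ => M)
    (s := K) (mem_interior_iff_mem_nhds.1 hxK) ?_ ?_ (hmeas _ hf'x) ?_ (by simp) ?_).2
  · filter_upwards [hU.mem_nhds hx] with w hw using hmeas _ (hf w hw)
  · exact (hf x hx).intervalIntegrable_of_Icc hab
  · exact .of_forall fun s hs w hw => hM (w, s) ⟨hw, hsub hs⟩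
  · exact .of_forall fun s hs w hw => hderiv w (hKU hw) s (hsub hs)

/-- The Cauchy-Schwarz inequality for nonnegative continuous functions on a compact interval. -/
theorem intervalIntegral_mul_le_sqrt_mul_sqrt {a b : ℝ} (hab : a ≤ b) {f g : ℝ → ℝ}
    (hf : ContinuousOn f (Icc a b)) (hg : ContinuousOn g (Icc a b))
    (hf0 : ∀ s ∈ Icc a b, 0 ≤ f s) (hg0 : ∀ s ∈ Icc a b, 0 ≤ g s) :
    ∫ s in a..b, f s * g s ≤ √(∫ s in a..b, f s ^ 2) * √(∫ s in a..b, g s ^ 2) := by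
  have hmem : ∀ h : ℝ → ℝ, ContinuousOn h (Icc a b) →
      MemLp h (ENNReal.ofReal 2) (volume.restrict (Ioc a b)) := by
    intro h hh
    rw [ENNReal.ofReal_ofNat, memLp_two_iff_integrable_sq
      ((hh.aestronglyMeasurable_of_isCompact isCompact_Icc measurableSet_Icc).mono_set
        Ioc_subset_Icc_self)]
    exact (hh.pow 2).integrableOn_Icc.mono_set Ioc_subset_Icc_self
  have hnonneg : ∀ h : ℝ → ℝ, (∀ s ∈ Icc a b, 0 ≤ h s) →
      0 ≤ᵐ[volume.restrict (Ioc a b)] h := fun h hh =>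
    ae_restrict_of_forall_mem measurableSet_Ioc fun s hs => hh s (Ioc_subset_Icc_self hs)
  have := integral_mul_le_Lp_mul_Lq_of_nonneg Real.HolderConjugate.two_two
    (hnonneg f hf0) (hnonneg g hg0) (hmem f hf) (hmem g hg)
  simpa only [integral_of_le hab, Real.sqrt_eq_rpow, Real.rpow_two] using this

theorem intervalIntegral_exp_neg_mul_sub_le {b : ℝ} (hb : 0 < b) (t : ℝ) :
    ∫ s in (0 : ℝ)..t, Real.exp (-(b * (t - s))) ≤ 1 / b := by
  have hd : ∀ s ∈ uIcc 0 t,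
      HasDerivAt (fun s => Real.exp (-(b * (t - s))) / b) (Real.exp (-(b * (t - s)))) s := by
    intro s _
    have h := ((((hasDerivAt_id' s).const_sub t).const_mul b).fun_neg.exp).div_const b
    refine h.congr_deriv ?_
    field_simp
  rw [integral_eq_sub_of_hasDerivAt hd (Continuous.intervalIntegrable (by fun_prop) _ _)]
  have : 0 < Real.exp (-(b * (t - 0))) / b := by positivity
  simp only [sub_self, mul_zero, neg_zero, Real.exp_zero]
  linarith

/-- A Cauchy-Schwarz bound for an integral against an exponentially decaying weight. -/
theorem norm_intervalIntegral_mul_le_of_sq_le_exp {t b K : ℝ} (ht : 0 ≤ t) (hb : 0 < b)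
    (hK : 0 ≤ K) {w : ℝ → ℝ} {f : ℝ → ℂ} (hw : ContinuousOn w (Icc 0 t))
    (hf : ContinuousOn f (Icc 0 t))
    (hwK : ∀ s ∈ Icc 0 t, w s ^ 2 ≤ K * Real.exp (-(b * (t - s)))) :
    ‖∫ s in (0 : ℝ)..t, (w s : ℂ) * f s‖ ≤
      √(K / b) * √(∫ s in (0 : ℝ)..t, ‖f s‖ ^ 2) := by
  calc ‖∫ s in (0 : ℝ)..t, (w s : ℂ) * f s‖
      ≤ ∫ s in (0 : ℝ)..t, ‖(w s : ℂ) * f s‖ := norm_integral_le_integral_norm ht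
    _ = ∫ s in (0 : ℝ)..t, |w s| * ‖f s‖ := by simp
    _ ≤ √(∫ s in (0 : ℝ)..t, |w s| ^ 2) * √(∫ s in (0 : ℝ)..t, ‖f s‖ ^ 2) :=
        intervalIntegral_mul_le_sqrt_mul_sqrt ht hw.abs hf.norm
          (fun _ _ => abs_nonneg _) (fun _ _ => norm_nonneg _)
    _ ≤ √(K / b) * √(∫ s in (0 : ℝ)..t, ‖f s‖ ^ 2) := by
        gcongr
        calc ∫ s in (0 : ℝ)..t, |w s| ^ 2
            ≤ ∫ s in (0 : ℝ)..t, K * Real.exp (-(b * (t - s))) := by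
              refine integral_mono_on ht
                ((hw.abs.pow 2).intervalIntegrable_of_Icc ht)
                (Continuous.intervalIntegrable (by fun_prop) _ _) fun s hs => ?_
              rw [sq_abs]
              exact hwK s hs
          _ = K * ∫ s in (0 : ℝ)..t, Real.exp (-(b * (t - s))) := by
              rw [intervalIntegral.integral_const_mul]
          _ ≤ K * (1 / b) := by
              gcongr
              exact intervalIntegral_exp_neg_mul_sub_le hb t
          _ = K / b := by ring

theorem sq_mul_exp_neg_le {x : ℝ} (hx : 0 ≤ x) :
    (x * Real.exp (-x)) ^ 2 ≤ 4 * Real.exp (-x) := by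
  have h : x ≤ 2 * Real.exp (x / 2) := by linarith [Real.add_one_le_exp (x / 2)]
  calc (x * Real.exp (-x)) ^ 2 ≤ (2 * Real.exp (x / 2) * Real.exp (-x)) ^ 2 := by gcongr
    _ = 4 * Real.exp (-x) := by
      rw [mul_assoc, ← Real.exp_add, mul_pow, ← Real.exp_nat_mul]
      norm_num
      ring

/-- The paper's Lemma 8.10: for `ν, c, t > 0` and `F : (0,∞) × [0,t] → ℂ` continuous with
continuous partial derivative `F'` in the first variable, the Duhamel integral
`G(z) = ∫₀ᵗ e^{−νz²c(t−τ)} F(z,τ) dτ` is differentiable on `(0,∞)` and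
`|G′(z)| ≤ 4ν^{−1/2} C₀(z)^{1/2}/(z²c^{1/2}) + (2ν)^{−1/2} C₂(z)^{1/2}/(zc^{1/2})`,
where `C₀(z) = ∫₀ᵗ |F(z,τ)|² dτ` and `C₂(z) = ∫₀ᵗ |F'(z,τ)|² dτ`. -/
theorem duhamel_deriv_estimate (ν c t : ℝ) (hν : 0 < ν) (hc : 0 < c) (ht : 0 < t)
    (F F' : ℝ → ℝ → ℂ)
    (hF : ContinuousOn (fun p : ℝ × ℝ => F p.1 p.2) (Set.Ioi 0 ×ˢ Set.Icc 0 t))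
    (hF' : ContinuousOn (fun p : ℝ × ℝ => F' p.1 p.2) (Set.Ioi 0 ×ˢ Set.Icc 0 t))
    (hderiv : ∀ z ∈ Set.Ioi (0:ℝ), ∀ τ ∈ Set.Icc (0:ℝ) t,
      HasDerivAt (fun w => F w τ) (F' z τ) z) :
    ∀ z ∈ Set.Ioi (0:ℝ),
      DifferentiableAt ℝ
        (fun w => ∫ τ in (0:ℝ)..t, (Real.exp (-(ν * w ^ 2 * c * (t - τ))) : ℂ) * F w τ) z ∧
      ‖deriv
          (fun w => ∫ τ in (0:ℝ)..t, (Real.exp (-(ν * w ^ 2 * c * (t - τ))) : ℂ) * F w τ) z‖ ≤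
        4 / Real.sqrt ν * Real.sqrt (∫ τ in (0:ℝ)..t, ‖F z τ‖ ^ 2) / (z ^ 2 * Real.sqrt c) +
          1 / Real.sqrt (2 * ν) * Real.sqrt (∫ τ in (0:ℝ)..t, ‖F' z τ‖ ^ 2) /
            (z * Real.sqrt c) := by
  intro z hz
  have hz0 : 0 < z := hz
  have hcont : ∀ {H : ℝ → ℝ → ℂ},
      ContinuousOn (fun p : ℝ × ℝ => H p.1 p.2) (Ioi 0 ×ˢ Icc 0 t) →
      ∀ w ∈ Ioi (0 : ℝ), ContinuousOn (H w) (Icc 0 t) := fun hH w hw =>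
    hH.comp (f := fun s => (w, s)) (by fun_prop) fun s hs => ⟨hw, hs⟩
  have hFz := hcont hF z hz
  have hF'z := hcont hF' z hz
  have key := hasDerivAt_intervalIntegral_of_continuousOn isOpen_Ioi ht.le
    (f := fun w τ => (Real.exp (-(ν * w ^ 2 * c * (t - τ))) : ℂ) * F w τ)
    (f' := fun w τ =>
      ((-(2 / w * (ν * w ^ 2 * c * (t - τ) * Real.exp (-(ν * w ^ 2 * c * (t - τ))))) : ℝ) : ℂ)
          * F w τ +
        (Real.exp (-(ν * w ^ 2 * c * (t - τ))) : ℂ) * F' w τ)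
    (fun w hw => (Continuous.continuousOn (by fun_prop)).mul (hcont hF w hw))
    (by
      refine ContinuousOn.add (ContinuousOn.mul ?_ hF)
        ((Continuous.continuousOn (by fun_prop)).mul hF')
      refine Complex.continuous_ofReal.comp_continuousOn (ContinuousOn.neg
        (ContinuousOn.mul ?_ (Continuous.continuousOn (by fun_prop))))
      exact continuousOn_const.div (by fun_prop) fun p hp => (mem_Ioi.1 hp.1).ne')
    (by
      intro w hw τ hτ
      have hw0 : w ≠ 0 := (mem_Ioi.1 hw).ne'
      have hlin : HasDerivAt (fun w : ℝ => -(ν * w ^ 2 * c * (t - τ)))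
          (-(ν * (2 * w) * c * (t - τ))) w := by
        simpa using ((((hasDerivAt_pow 2 w).const_mul ν).mul_const c).mul_const (t - τ)).fun_neg
      refine (hlin.exp.ofReal_comp.mul (hderiv w hw τ hτ)).congr_deriv ?_
      congr 3
      field_simp)
    hz
  refine ⟨key.differentiableAt, ?_⟩
  have ha : 0 < ν * z ^ 2 * c := by positivity
  have hsplit := intervalIntegral.integral_add (μ := volume) (a := 0) (b := t)
    (f := fun τ =>
      ((-(2 / z * (ν * z ^ 2 * c * (t - τ) * Real.exp (-(ν * z ^ 2 * c * (t - τ))))) : ℝ) : ℂ)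
          * F z τ)
    (g := fun τ => (Real.exp (-(ν * z ^ 2 * c * (t - τ))) : ℂ) * F' z τ)
    (ContinuousOn.intervalIntegrable_of_Icc ht.le
      ((Continuous.continuousOn (by fun_prop)).mul hFz))
    (ContinuousOn.intervalIntegrable_of_Icc ht.le
      ((Continuous.continuousOn (by fun_prop)).mul hF'z))
  rw [key.deriv, hsplit]
  refine (norm_add_le _ _).trans (add_le_add ?_ ?_)
  · refine (norm_intervalIntegral_mul_le_of_sq_le_exp (b := ν * z ^ 2 * c)
      (K := (4 / z) ^ 2) ht.le ha (by positivity) (Continuous.continuousOn (by fun_prop)) hFz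
      fun s hs => ?_).trans_eq ?_
    · have hs0 : 0 ≤ ν * z ^ 2 * c * (t - s) := mul_nonneg ha.le (sub_nonneg.2 hs.2)
      rw [neg_sq, mul_pow]
      calc _ ≤ (2 / z) ^ 2 * (4 * Real.exp (-(ν * z ^ 2 * c * (t - s)))) := by
            gcongr
            exact sq_mul_exp_neg_le hs0
        _ = _ := by ring
    · rw [Real.sqrt_div (by positivity), Real.sqrt_sq (by positivity),
        Real.sqrt_mul (by positivity), Real.sqrt_mul hν.le, Real.sqrt_sq hz0.le]
      field_simp
  · refine (norm_intervalIntegral_mul_le_of_sq_le_exp (b := 2 * ν * z ^ 2 * c)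
      (K := 1) ht.le (by positivity) zero_le_one (Continuous.continuousOn (by fun_prop)) hF'z
      fun s hs => ?_).trans_eq ?_
    · rw [one_mul, ← Real.exp_nat_mul]
      refine (congrArg Real.exp ?_).le
      push_cast
      ring
    · rw [Real.sqrt_div zero_le_one, Real.sqrt_one,
        Real.sqrt_mul (by positivity), Real.sqrt_mul (by positivity), Real.sqrt_sq hz0.le]
      field_simp
end

section
/- Let ν > 0, c > 0, t > 0, and let F : (0,∞) × [0,t] → ℂ be continuous with continuous partial derivatives ∂₁F and ∂₁²F in the first variable. Define G(z) = ∫₀ᵗ e^{−ν z² c (t−τ)} F(z,τ) dτ for z > 0. Then G is twice differentiable on (0,∞) and for every z > 0, |G″(z)| ≤ 16 ν^{−1/2} C₀(z)^{1/2} / (z³ c^{1/2}) + 8 ν^{−1/2} C₂(z)^{1/2} / (z² c^{1/2}) + (2ν)^{−1/2} C₄(z)^{1/2} / (z c^{1/2}), where C₀(z) = ∫₀ᵗ |F(z,τ)|² dτ, C₂(z) = ∫₀ᵗ |∂₁F(z,τ)|² dτ and C₄(z) = ∫₀ᵗ |∂₁²F(z,τ)|² dτ. (This is the content of the paper's Lemma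 8.11: the bound on the second z-derivative of the Duhamel integral in the Fourier representation of the Navier–Stokes solution.) -/
open MeasureTheory Real

/-- Differentiation under the integral sign over a compact interval, for an integrand which is
jointly continuous together with its partial derivative on `(0,∞) × [0,t]`. -/
theorem hasDerivAt_integral_of_continuousOn_Ioi {t : ℝ} (ht : 0 ≤ t) {H H' : ℝ → ℝ → ℂ}
    (hH : ContinuousOn (fun p : ℝ × ℝ => H p.1 p.2) (Set.Ioi 0 ×ˢ Set.Icc 0 t))
    (hH' : ContinuousOn (fun p : ℝ × ℝ => H' p.1 p.2) (Set.Ioi 0 ×ˢ Set.Icc 0 t))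
    (hd : ∀ z ∈ Set.Ioi (0:ℝ), ∀ τ ∈ Set.Icc (0:ℝ) t, HasDerivAt (fun w => H w τ) (H' z τ) z)
    {z : ℝ} (hz : 0 < z) :
    HasDerivAt (fun w => ∫ τ in (0:ℝ)..t, H w τ) (∫ τ in (0:ℝ)..t, H' z τ) z := by
  have slice : ∀ {K : ℝ → ℝ → ℂ},
      ContinuousOn (fun p : ℝ × ℝ => K p.1 p.2) (Set.Ioi 0 ×ˢ Set.Icc 0 t) →
      ∀ w, 0 < w → IntervalIntegrable (K w) volume 0 t := by
    intro K hK w hw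
    apply ContinuousOn.intervalIntegrable
    rw [Set.uIcc_of_le ht]
    exact hK.comp (f := fun τ : ℝ => (w, τ)) (by fun_prop) fun τ hτ => ⟨hw, hτ⟩
  obtain ⟨C, hC⟩ := (isCompact_Icc.prod isCompact_Icc : IsCompact
    (Set.Icc (z / 2) (2 * z) ×ˢ Set.Icc 0 t)).exists_bound_of_continuousOn
    (hH'.mono (Set.prod_mono (fun x hx => lt_of_lt_of_le (half_pos hz) hx.1) subset_rfl))
  refine (intervalIntegral.hasDerivAt_integral_of_dominated_loc_of_deriv_le
    (bound := fun _ => C) (Icc_mem_nhds (by linarith : z / 2 < z) (by linarith : z < 2 * z))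
    ?_ (slice hH z hz) (intervalIntegrable_iff.1 (slice hH' z hz)).aestronglyMeasurable ?_
    intervalIntegrable_const ?_).2
  · filter_upwards [Ioi_mem_nhds hz] with w hw
    exact (intervalIntegrable_iff.1 (slice hH w hw)).aestronglyMeasurable
  · refine Filter.Eventually.of_forall fun τ hτ w hw => hC (w, τ) ⟨hw, ?_⟩
    rw [Set.uIoc_of_le ht] at hτ
    exact Set.Ioc_subset_Icc_self hτ
  · refine Filter.Eventually.of_forall fun τ hτ w hw => hd w ?_ τ ?_
    · exact lt_of_lt_of_le (half_pos hz) hw.1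
    · rw [Set.uIoc_of_le ht] at hτ
      exact Set.Ioc_subset_Icc_self hτ

theorem sq_integral_mul_le_of_continuousOn {a b : ℝ} (hab : a ≤ b) {f g : ℝ → ℝ}
    (hf : ContinuousOn f (Set.Icc a b)) (hg : ContinuousOn g (Set.Icc a b)) :
    (∫ x in a..b, f x * g x) ^ 2 ≤ (∫ x in a..b, f x ^ 2) * ∫ x in a..b, g x ^ 2 := by
  have int : ∀ {h : ℝ → ℝ}, ContinuousOn h (Set.Icc a b) → IntervalIntegrable h volume a b :=
    fun hh => ContinuousOn.intervalIntegrable (by rwa [Set.uIcc_of_le hab])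
  have hff : IntervalIntegrable (fun x => f x ^ 2) volume a b := int (hf.pow 2)
  have hgg : IntervalIntegrable (fun x => g x ^ 2) volume a b := int (hg.pow 2)
  have hfg : IntervalIntegrable (fun x => f x * g x) volume a b := int (hf.mul hg)
  have key : ∀ s : ℝ, 0 ≤ (∫ x in a..b, f x ^ 2) * (s * s) + (2 * ∫ x in a..b, f x * g x) * s +
      ∫ x in a..b, g x ^ 2 := by
    intro s
    have h0 : 0 ≤ ∫ x in a..b, (f x * s + g x) ^ 2 :=
      intervalIntegral.integral_nonneg hab fun x _ => sq_nonneg _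
    have h1 : ∫ x in a..b, (f x * s + g x) ^ 2 =
        ∫ x in a..b, (f x ^ 2 * (s * s) + f x * g x * (2 * s) + g x ^ 2) := by
      congr 1; ext x; ring
    rw [h1, intervalIntegral.integral_add ((hff.mul_const _).add (hfg.mul_const _)) hgg,
      intervalIntegral.integral_add (hff.mul_const _) (hfg.mul_const _),
      intervalIntegral.integral_mul_const, intervalIntegral.integral_mul_const] at h0
    linarith
  have := discrim_le_zero key
  unfold discrim at this
  nlinarith

theorem integral_exp_neg_mul_sub_le {b t : ℝ} (hb : 0 < b) :
    ∫ τ in (0:ℝ)..t, Real.exp (-(b * (t - τ))) ≤ 1 / b := by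
  have hd : ∀ x ∈ Set.uIcc 0 t, HasDerivAt (fun τ => Real.exp (-(b * (t - τ))) / b)
      (Real.exp (-(b * (t - x)))) x := by
    intro x _
    have := (((((hasDerivAt_id x).const_sub t).const_mul b).neg).exp).div_const b
    refine this.congr_deriv ?_
    simp only [Pi.neg_apply, id, mul_neg, mul_one, neg_neg]
    field_simp
  rw [intervalIntegral.integral_eq_sub_of_hasDerivAt hd
    (Continuous.intervalIntegrable (by fun_prop) _ _)]
  have : 0 ≤ Real.exp (-(b * (t - 0))) / b := by positivity
  simp only [sub_self, mul_zero, neg_zero, Real.exp_zero]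
  linarith

theorem norm_integral_mul_le_of_abs_le_exp {b t K : ℝ} (hb : 0 < b) (ht : 0 ≤ t) (hK : 0 ≤ K)
    {k : ℝ → ℝ} {f : ℝ → ℂ} (hf : ContinuousOn f (Set.Icc 0 t))
    (hk : ∀ τ ∈ Set.Icc 0 t, |k τ| ≤ K * Real.exp (-(b / 2 * (t - τ)))) :
    ‖∫ τ in (0:ℝ)..t, (k τ : ℂ) * f τ‖ ≤ K / √b * √(∫ τ in (0:ℝ)..t, ‖f τ‖ ^ 2) := by
  have hE : ContinuousOn (fun τ => Real.exp (-(b / 2 * (t - τ)))) (Set.Icc 0 t) := by fun_prop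
  have h1 : ‖∫ τ in (0:ℝ)..t, (k τ : ℂ) * f τ‖ ≤
      ∫ τ in (0:ℝ)..t, K * (Real.exp (-(b / 2 * (t - τ))) * ‖f τ‖) := by
    refine intervalIntegral.norm_integral_le_of_norm_le ht
      (Filter.Eventually.of_forall fun τ hτ => ?_) ?_
    · rw [norm_mul, Complex.norm_real, Real.norm_eq_abs, ← mul_assoc]
      gcongr
      exact hk τ (Set.Ioc_subset_Icc_self hτ)
    · apply ContinuousOn.intervalIntegrable
      rw [Set.uIcc_of_le ht]
      exact continuousOn_const.mul (hE.mul hf.norm)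
  have h2 := sq_integral_mul_le_of_continuousOn ht hE hf.norm
  have h3 : ∫ τ in (0:ℝ)..t, Real.exp (-(b / 2 * (t - τ))) ^ 2 ≤ 1 / b := by
    convert integral_exp_neg_mul_sub_le (t := t) hb using 3 with τ
    rw [← Real.exp_nat_mul]
    congr 1
    push_cast
    ring
  have hQ : 0 ≤ ∫ τ in (0:ℝ)..t, ‖f τ‖ ^ 2 :=
    intervalIntegral.integral_nonneg ht fun x _ => sq_nonneg _
  have h4 : ∫ τ in (0:ℝ)..t, Real.exp (-(b / 2 * (t - τ))) * ‖f τ‖ ≤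
      1 / √b * √(∫ τ in (0:ℝ)..t, ‖f τ‖ ^ 2) := by
    have hb' : 1 / √b = √(1 / b) := by rw [Real.sqrt_div zero_le_one, Real.sqrt_one]
    rw [hb', ← Real.sqrt_mul (by positivity)]
    exact Real.le_sqrt_of_sq_le (h2.trans (by gcongr))
  rw [intervalIntegral.integral_const_mul] at h1
  calc _ ≤ _ := h1
    _ ≤ K * (1 / √b * √(∫ τ in (0:ℝ)..t, ‖f τ‖ ^ 2)) := by gcongr
    _ = _ := by ring

theorem abs_mul_exp_neg_le {x : ℝ} (hx : 0 ≤ x) :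
    |-(4 * x) * Real.exp (-x)| ≤ 8 * Real.exp (-(x / 2)) := by
  have h1 := Real.add_one_le_exp (x / 2)
  have h2 : Real.exp (-(x / 2)) = Real.exp (x / 2) * Real.exp (-x) := by
    rw [← Real.exp_add]; congr 1; ring
  rw [h2, abs_mul, Real.abs_exp, ← mul_assoc]
  gcongr
  rw [abs_neg, abs_of_nonneg (by linarith)]
  linarith

theorem abs_quadratic_mul_exp_neg_le {x : ℝ} (hx : 0 ≤ x) :
    |(4 * x ^ 2 - 2 * x) * Real.exp (-x)| ≤ 16 * Real.exp (-(x / 2)) := by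
  have h1 : 1 + x / 2 + x ^ 2 / 8 + x ^ 3 / 48 ≤ Real.exp (x / 2) := by
    have := Real.sum_le_exp_of_nonneg (x := x / 2) (by linarith) 4
    simp only [Finset.sum_range_succ, Finset.sum_range_zero, Nat.factorial] at this
    norm_num at this
    linarith
  have h2 : Real.exp (-(x / 2)) = Real.exp (x / 2) * Real.exp (-x) := by
    rw [← Real.exp_add]; congr 1; ring
  rw [h2, abs_mul, Real.abs_exp, ← mul_assoc]
  gcongr
  rw [abs_le]
  constructor
  · nlinarith [pow_nonneg hx 3, pow_nonneg hx 2]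
  · nlinarith [mul_nonneg hx (sq_nonneg (x - 3)), pow_nonneg hx 3, pow_nonneg hx 2]

/-- The paper's Lemma 8.11: for `ν, c, t > 0` and `F : (0,∞) × [0,t] → ℂ` continuous with
continuous first and second partial derivatives `F'`, `F''` in the first variable, the
Duhamel integral `G(z) = ∫₀ᵗ e^{−νz²c(t−τ)} F(z,τ) dτ` is twice differentiable on `(0,∞)` and
`|G″(z)| ≤ 16ν^{−1/2} C₀(z)^{1/2}/(z³c^{1/2}) + 8ν^{−1/2} C₂(z)^{1/2}/(z²c^{1/2})
+ (2ν)^{−1/2} C₄(z)^{1/2}/(zc^{1/2})`, where `C₀(z) = ∫₀ᵗ |F(z,τ)|² dτ`,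
`C₂(z) = ∫₀ᵗ |F'(z,τ)|² dτ` and `C₄(z) = ∫₀ᵗ |F''(z,τ)|² dτ`. -/
theorem duhamel_second_deriv_estimate (ν c t : ℝ) (hν : 0 < ν) (hc : 0 < c) (ht : 0 < t)
    (F F' F'' : ℝ → ℝ → ℂ)
    (hF : ContinuousOn (fun p : ℝ × ℝ => F p.1 p.2) (Set.Ioi 0 ×ˢ Set.Icc 0 t))
    (hF' : ContinuousOn (fun p : ℝ × ℝ => F' p.1 p.2) (Set.Ioi 0 ×ˢ Set.Icc 0 t))
    (hF'' : ContinuousOn (fun p : ℝ × ℝ => F'' p.1 p.2) (Set.Ioi 0 ×ˢ Set.Icc 0 t))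
    (hderiv : ∀ z ∈ Set.Ioi (0:ℝ), ∀ τ ∈ Set.Icc (0:ℝ) t,
      HasDerivAt (fun w => F w τ) (F' z τ) z)
    (hderiv' : ∀ z ∈ Set.Ioi (0:ℝ), ∀ τ ∈ Set.Icc (0:ℝ) t,
      HasDerivAt (fun w => F' w τ) (F'' z τ) z) :
    ∀ z ∈ Set.Ioi (0:ℝ),
      DifferentiableAt ℝ
        (fun w => ∫ τ in (0:ℝ)..t, (Real.exp (-(ν * w ^ 2 * c * (t - τ))) : ℂ) * F w τ) z ∧
      DifferentiableAt ℝ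
        (deriv
          (fun w => ∫ τ in (0:ℝ)..t, (Real.exp (-(ν * w ^ 2 * c * (t - τ))) : ℂ) * F w τ)) z ∧
      ‖deriv
          (deriv
            (fun w => ∫ τ in (0:ℝ)..t, (Real.exp (-(ν * w ^ 2 * c * (t - τ))) : ℂ) * F w τ))
          z‖ ≤
        16 / Real.sqrt ν * Real.sqrt (∫ τ in (0:ℝ)..t, ‖F z τ‖ ^ 2) / (z ^ 3 * Real.sqrt c) +
          8 / Real.sqrt ν * Real.sqrt (∫ τ in (0:ℝ)..t, ‖F' z τ‖ ^ 2) / (z ^ 2 * Real.sqrt c) +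
          1 / Real.sqrt (2 * ν) * Real.sqrt (∫ τ in (0:ℝ)..t, ‖F'' z τ‖ ^ 2) /
            (z * Real.sqrt c) := by
  set e : ℝ → ℝ → ℝ := fun w τ => Real.exp (-(ν * w ^ 2 * c * (t - τ))) with he
  set e₁ : ℝ → ℝ → ℝ := fun w τ => -(2 * ν * w * c * (t - τ)) * e w τ with he₁
  set e₂ : ℝ → ℝ → ℝ := fun w τ =>
    ((2 * ν * w * c * (t - τ)) ^ 2 - 2 * ν * c * (t - τ)) * e w τ with he₂
  have hde : ∀ w τ, HasDerivAt (fun w => e w τ) (e₁ w τ) w := by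
    intro w τ
    have h := ((((((hasDerivAt_id w).pow 2).const_mul ν).mul_const c).mul_const (t - τ)).neg).exp
    refine h.congr_deriv ?_
    simp only [he₁, he, Pi.neg_apply, Pi.pow_apply, id]
    push_cast
    ring
  have hde₁ : ∀ w τ, HasDerivAt (fun w => e₁ w τ) (e₂ w τ) w := by
    intro w τ
    have h := ((((hasDerivAt_id w).const_mul (2 * ν)).mul_const c).mul_const (t - τ)).neg.mul
      (hde w τ)
    refine h.congr_deriv ?_
    simp only [he₁, he₂, Pi.neg_apply, id]
    ring
  set S : Set (ℝ × ℝ) := Set.Ioi 0 ×ˢ Set.Icc 0 t with hS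
  have hce : ContinuousOn (fun p : ℝ × ℝ => (e p.1 p.2 : ℂ)) S := by
    simp only [he]; fun_prop
  have hce₁ : ContinuousOn (fun p : ℝ × ℝ => (e₁ p.1 p.2 : ℂ)) S := by
    simp only [he₁, he]; fun_prop
  have hce₂ : ContinuousOn (fun p : ℝ × ℝ => (e₂ p.1 p.2 : ℂ)) S := by
    simp only [he₂, he]; fun_prop
  have hG : ∀ z : ℝ, 0 < z → HasDerivAt (fun w => ∫ τ in (0:ℝ)..t, (e w τ : ℂ) * F w τ)
      (∫ τ in (0:ℝ)..t, ((e₁ z τ : ℂ) * F z τ + (e z τ : ℂ) * F' z τ)) z := fun z hz =>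
    hasDerivAt_integral_of_continuousOn_Ioi ht.le
      (H := fun w τ => (e w τ : ℂ) * F w τ)
      (H' := fun w τ => (e₁ w τ : ℂ) * F w τ + (e w τ : ℂ) * F' w τ)
      (hce.mul hF) ((hce₁.mul hF).add (hce.mul hF'))
      (fun z hz τ hτ => (hde z τ).ofReal_comp.mul (hderiv z hz τ hτ)) hz
  have hG' : ∀ z : ℝ, 0 < z → HasDerivAt
      (fun w => ∫ τ in (0:ℝ)..t, ((e₁ w τ : ℂ) * F w τ + (e w τ : ℂ) * F' w τ))
      (∫ τ in (0:ℝ)..t, (((e₂ z τ : ℂ) * F z τ + (e₁ z τ : ℂ) * F' z τ) +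
        ((e₁ z τ : ℂ) * F' z τ + (e z τ : ℂ) * F'' z τ))) z := fun z hz =>
    hasDerivAt_integral_of_continuousOn_Ioi ht.le
      (H := fun w τ => (e₁ w τ : ℂ) * F w τ + (e w τ : ℂ) * F' w τ)
      (H' := fun w τ => ((e₂ w τ : ℂ) * F w τ + (e₁ w τ : ℂ) * F' w τ) +
        ((e₁ w τ : ℂ) * F' w τ + (e w τ : ℂ) * F'' w τ))
      ((hce₁.mul hF).add (hce.mul hF'))
      (((hce₂.mul hF).add (hce₁.mul hF')).add ((hce₁.mul hF').add (hce.mul hF'')))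
      (fun z hz τ hτ => ((hde₁ z τ).ofReal_comp.mul (hderiv z hz τ hτ)).add
        ((hde z τ).ofReal_comp.mul (hderiv' z hz τ hτ))) hz
  intro z hz
  replace hz : 0 < z := hz
  have hderivG : deriv (fun w => ∫ τ in (0:ℝ)..t, (e w τ : ℂ) * F w τ) =ᶠ[nhds z]
      fun w => ∫ τ in (0:ℝ)..t, ((e₁ w τ : ℂ) * F w τ + (e w τ : ℂ) * F' w τ) := by
    filter_upwards [Ioi_mem_nhds hz] with w hw using (hG w hw).deriv
  have hG'' := (hG' z hz).congr_of_eventuallyEq hderivG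
  refine ⟨(hG z hz).differentiableAt, hG''.differentiableAt, ?_⟩
  rw [hG''.deriv]
  have slice : ∀ {K : ℝ → ℝ → ℂ}, ContinuousOn (fun p : ℝ × ℝ => K p.1 p.2) S →
      ContinuousOn (K z) (Set.Icc 0 t) := fun hK =>
    hK.comp (f := fun τ : ℝ => (z, τ)) (by fun_prop) fun τ hτ => ⟨hz, hτ⟩
  have int : ∀ {k : ℝ → ℝ → ℝ} {K : ℝ → ℝ → ℂ},
      ContinuousOn (fun p : ℝ × ℝ => (k p.1 p.2 : ℂ)) S →
      ContinuousOn (fun p : ℝ × ℝ => K p.1 p.2) S →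
      IntervalIntegrable (fun τ => (k z τ : ℂ) * K z τ) volume 0 t := by
    intro k K hk hK
    apply ContinuousOn.intervalIntegrable
    rw [Set.uIcc_of_le ht.le]
    exact slice (K := fun w τ => (k w τ : ℂ) * K w τ) (hk.mul hK)
  have hsplit : (∫ τ in (0:ℝ)..t, (((e₂ z τ : ℂ) * F z τ + (e₁ z τ : ℂ) * F' z τ) +
        ((e₁ z τ : ℂ) * F' z τ + (e z τ : ℂ) * F'' z τ))) =
      (∫ τ in (0:ℝ)..t, (e₂ z τ : ℂ) * F z τ) +
      (∫ τ in (0:ℝ)..t, ((2 * e₁ z τ : ℝ) : ℂ) * F' z τ) +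
      ∫ τ in (0:ℝ)..t, (e z τ : ℂ) * F'' z τ := by
    have h2 : (∫ τ in (0:ℝ)..t, ((2 * e₁ z τ : ℝ) : ℂ) * F' z τ) =
        2 * ∫ τ in (0:ℝ)..t, (e₁ z τ : ℂ) * F' z τ := by
      rw [← intervalIntegral.integral_const_mul]
      congr 1; ext τ; push_cast; ring
    rw [intervalIntegral.integral_add ((int hce₂ hF).add (int hce₁ hF'))
        ((int hce₁ hF').add (int hce hF'')),
      intervalIntegral.integral_add (int hce₂ hF) (int hce₁ hF'),
      intervalIntegral.integral_add (int hce₁ hF') (int hce hF''), h2]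
    ring
  rw [hsplit]
  have ha : 0 < ν * z ^ 2 * c := by positivity
  have hsqrt : ∀ m : ℝ, 0 ≤ m → √(m * z ^ 2 * c) = √m * z * √c := fun m hm => by
    rw [Real.sqrt_mul (by positivity), Real.sqrt_mul hm, Real.sqrt_sq hz.le]
  refine norm_add₃_le.trans (add_le_add_three ?_ ?_ ?_)
  · refine (norm_integral_mul_le_of_abs_le_exp (K := 16 / z ^ 2) ha ht.le (by positivity)
      (slice hF) fun τ hτ => ?_).trans_eq ?_
    · have h := abs_quadratic_mul_exp_neg_le
        (mul_nonneg ha.le (sub_nonneg.2 hτ.2) : 0 ≤ ν * z ^ 2 * c * (t - τ))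
      have heq : e₂ z τ = ((4 * (ν * z ^ 2 * c * (t - τ)) ^ 2 - 2 * (ν * z ^ 2 * c * (t - τ))) *
          Real.exp (-(ν * z ^ 2 * c * (t - τ)))) / z ^ 2 := by
        simp only [he₂, he]; field_simp; ring
      rw [heq, abs_div, abs_of_pos (by positivity : 0 < z ^ 2), div_mul_eq_mul_div]
      refine div_le_div_of_nonneg_right (h.trans_eq ?_) (by positivity)
      ring_nf
    · rw [hsqrt ν hν.le]; field_simp
  · refine (norm_integral_mul_le_of_abs_le_exp (K := 8 / z) ha ht.le (by positivity)
      (slice hF') fun τ hτ => ?_).trans_eq ?_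
    · have h := abs_mul_exp_neg_le
        (mul_nonneg ha.le (sub_nonneg.2 hτ.2) : 0 ≤ ν * z ^ 2 * c * (t - τ))
      have heq : 2 * e₁ z τ = (-(4 * (ν * z ^ 2 * c * (t - τ))) *
          Real.exp (-(ν * z ^ 2 * c * (t - τ)))) / z := by
        simp only [he₁, he]; field_simp; ring
      rw [heq, abs_div, abs_of_pos hz, div_mul_eq_mul_div]
      refine div_le_div_of_nonneg_right (h.trans_eq ?_) hz.le
      ring_nf
    · rw [hsqrt ν hν.le]; field_simp
  · refine (norm_integral_mul_le_of_abs_le_exp (b := 2 * ν * z ^ 2 * c) (K := 1) (by positivity)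
      ht.le zero_le_one (slice hF'') fun τ hτ => le_of_eq ?_).trans_eq ?_
    · simp only [he, Real.abs_exp, one_mul]
      ring_nf
    · rw [hsqrt (2 * ν) (by positivity)]; field_simp
end
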